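/- arXiv:2510.22308 — 4 statements merged into one kernel-verified Lean document; each statement's English description precedes it below -/
import Mathlib

section
/- Let n ≥ 1 and p ≥ 1. The map φ̃₁ sending τ₁ to the composition τ₁ ∘ τ₀ is a bijection from b̃_{1,p}(n) onto ÑC₂^{δ,p}(2n,−2n). -/
open Equiv MeasureTheory ProbabilityTheory

noncomputable section

namespace RibbonNC

/-- The number of cycles `#(σ)` of a permutation, counted on the finite set `S`:
the number of orbits of `σ` meeting `S` (fixed points count as orbits). -/
def cyclesOn {α : Type*} (σ : Equiv.Perm α) (S : Finset α) : ℕ :=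
  ((fun a => {b | σ.SameCycle a b}) '' (S : Set α)).ncard

/-- `σ` is a permutation of `S`: it fixes everything outside `S`. -/
def IsPermOn {α : Type*} (σ : Equiv.Perm α) (S : Finset α) : Prop :=
  ∀ a ∉ S, σ a = a

/-- `σ` is a pairing of `S`: a fixed-point-free involution of `S`, fixing everything
outside `S`. -/
def IsPairingOn {α : Type*} (σ : Equiv.Perm α) (S : Finset α) : Prop :=
  σ * σ = 1 ∧ (∀ a ∈ S, σ a ≠ a) ∧ IsPermOn σ S

/-- `π` is non-crossing with respect to `γ` on `S`: the subgroup generated by `π` and `γ`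
acts transitively on `S`, and `#(π) + #(π⁻¹γ) + #(γ) = |S| + 2`. -/
def IsNoncrossingOn {α : Type*} (π γ : Equiv.Perm α) (S : Finset α) : Prop :=
  (∀ a ∈ S, ∀ b ∈ S, ∃ σ ∈ Subgroup.closure ({π, γ} : Set (Equiv.Perm α)), σ a = b) ∧
  cyclesOn π S + cyclesOn (π⁻¹ * γ) S + cyclesOn γ S = S.card + 2

/-- `[n] = {1, …, n}`, as a finset of integers. -/
def posSet (n : ℕ) : Finset ℤ := Finset.Icc 1 (n : ℤ)

/-- `±[n] = {−n, …, −1} ∪ {1, …, n}`, as a finset of integers. -/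
def pmSet (n : ℕ) : Finset ℤ := Finset.Icc (-(n : ℤ)) (n : ℤ) \ {0}

/-- The cyclic permutation `γ_n = (1, 2, …, n)` of `[n]`. -/
def gammaZ (n : ℕ) : Equiv.Perm ℤ := ((List.range n).map fun i => ((i : ℤ) + 1)).formPerm

/-- The permutation `γ̃_n = (1, 2, …, n)(−n, …, −2, −1)` of `±[n]`. -/
def gammaTildeZ (n : ℕ) : Equiv.Perm ℤ :=
  gammaZ n * ((List.range n).map fun i => ((i : ℤ) - (n : ℤ))).formPerm

/-- The involution `τ₀ : a ↦ −a` on `±[n]`, fixing everything outside. -/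
def tau0 (n : ℕ) : Equiv.Perm ℤ :=
  ((List.range n).map fun i => Equiv.swap ((i : ℤ) + 1) (-((i : ℤ) + 1))).prod

/-- The involution `τ₂` on `±[n]`, pairing `−k` with `k+1` for `1 ≤ k ≤ n−1`, and `−n`
with `1`. -/
def tau2 (n : ℕ) : Equiv.Perm ℤ :=
  ((List.range (n - 1)).map fun i => Equiv.swap (-((i : ℤ) + 1)) ((i : ℤ) + 2)).prod *
    Equiv.swap (-(n : ℤ)) 1

/-- The `δ`-condition for a permutation of `S = ±[n]`: no cycle of the form `(r, −r)`,
and together with every cycle `(r₁, …, r_s)`, the cycle `(−r_s, …, −r₁)` also occurs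
(the latter is equivalent to `π(−a) = −π⁻¹(a)` for all `a`). -/
def IsDeltaOn (π : Equiv.Perm ℤ) (S : Finset ℤ) : Prop :=
  (∀ r ∈ S, ¬(π r = -r ∧ π (-r) = r)) ∧ ∀ a : ℤ, π (-a) = -(π⁻¹ a)

/-- `a_g(n) = {π ∈ P₂(n) : #(π⁻¹γ_n) = n/2 + 1 − 2g}`. -/
def aSet (g n : ℕ) : Set (Equiv.Perm ℤ) :=
  {π | IsPairingOn π (posSet n) ∧ cyclesOn (π⁻¹ * gammaZ n) (posSet n) + 2 * g = n / 2 + 1}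

/-- `b_k(n)`. -/
def bSet (k n : ℕ) : Set (Equiv.Perm ℤ) :=
  {τ₁ | IsPairingOn τ₁ (pmSet n) ∧ cyclesOn (tau2 n * τ₁) (pmSet n) + 2 * k = n + 2 ∧
    tau0 n * τ₁ = τ₁ * tau0 n ∧ (∀ a ∈ pmSet n, (tau0 n * τ₁) a ≠ a) ∧
    ∃ a ∈ posSet n, τ₁ a ∈ posSet n}

/-- `NC₂^δ(n, −n)`, the symmetric non-crossing annular pairings of `±[n]`. -/
def ncDelta2 (n : ℕ) : Set (Equiv.Perm ℤ) :=
  {π | IsPairingOn π (pmSet n) ∧ IsNoncrossingOn π (gammaTildeZ n) (pmSet n) ∧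
    IsDeltaOn π (pmSet n)}

/-- `γ_{n,u,v} = γ_n · (u−1, v)`, with `(0, v)` read as `(n, v)` when `u = 1`. -/
def gammaUV (n : ℕ) (u v : ℤ) : Equiv.Perm ℤ :=
  gammaZ n * Equiv.swap (if u = 1 then (n : ℤ) else u - 1) v

/-- `NC₂^T_{u,v}(n)`. -/
def ncT2uv (n : ℕ) (u v : ℤ) : Set (Equiv.Perm ℤ) :=
  {π | IsPairingOn π (posSet n) ∧ IsNoncrossingOn π (gammaUV n u v) (posSet n) ∧
    π u = v ∧ ∀ a : ℤ, 1 ≤ a → a < u → π a ∈ posSet n ∧ ¬(u ≤ π a ∧ π a ≤ v)}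

/-- `NC₂^T(n)`. -/
def ncT2 (n : ℕ) : Set (Equiv.Perm ℤ) :=
  {π | ∃ u v : ℤ, 1 ≤ u ∧ u < v ∧ v < (n : ℤ) ∧ π ∈ ncT2uv n u v}

/-- `γ̃_{n,u,v} = γ̃_n · (−u, v−1) · (−v, u−1)`, with `(−v, 0)` read as `(−v, n)` when
`u = 1`. -/
def gammaTildeUV (n : ℕ) (u v : ℤ) : Equiv.Perm ℤ :=
  gammaTildeZ n * Equiv.swap (-u) (v - 1) *
    Equiv.swap (-v) (if u = 1 then (n : ℤ) else u - 1)

/-- `NC₂^K_{u,v}(n)`. -/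
def ncK2uv (n : ℕ) (u v : ℤ) : Set (Equiv.Perm ℤ) :=
  {π | IsPairingOn π (pmSet n) ∧ IsNoncrossingOn π (gammaTildeUV n u v) (pmSet n) ∧
    IsDeltaOn π (pmSet n) ∧ π u = -v ∧ ∀ a : ℤ, 1 ≤ a → a < u → π a ∈ posSet n}

/-- `NC₂^K(n)`. -/
def ncK2 (n : ℕ) : Set (Equiv.Perm ℤ) :=
  {π | ∃ u v : ℤ, 1 ≤ u ∧ u < v ∧ v < (n : ℤ) ∧ π ∈ ncK2uv n u v}

/-- The odd elements `{1, 3, …, 2n−1}` of `[2n]`. -/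
def oddPosSet (n : ℕ) : Finset ℤ := (posSet (2 * n)).filter fun a => Odd a

/-- `ã_{g,p}(n)`. -/
def aTildeSet (g p n : ℕ) : Set (Equiv.Perm ℤ) :=
  {π | π ∈ aSet g (2 * n) ∧ (∀ a ∈ posSet (2 * n), Even a → Odd (π a)) ∧
    cyclesOn (π⁻¹ * gammaZ (2 * n)) (oddPosSet n) = p}

/-- `B(n) = {1, 3, …, 2n−1} ∪ {−2, −4, …, −2n} ⊂ ±[2n]`. -/
def BSet (n : ℕ) : Finset ℤ :=
  (pmSet (2 * n)).filter fun a => (0 < a ∧ Odd a) ∨ (a < 0 ∧ Even a)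

/-- `W(n) = {2, 4, …, 2n} ∪ {−1, −3, …, −(2n−1)} ⊂ ±[2n]`. -/
def WSet (n : ℕ) : Finset ℤ :=
  (pmSet (2 * n)).filter fun a => (0 < a ∧ Even a) ∨ (a < 0 ∧ Odd a)

/-- `b̃_{k,p}(n)`. -/
def bTildeSet (k p n : ℕ) : Set (Equiv.Perm ℤ) :=
  {τ₁ | τ₁ ∈ bSet k (2 * n) ∧ (∀ a ∈ BSet n, τ₁ a ∈ BSet n) ∧
    cyclesOn (tau2 (2 * n) * τ₁) (WSet n) = 2 * p}

/-- `â_{g,p}(n) = {π ∈ S_{[n]} : #(π) = p, #(π⁻¹γ_n) = n − p + 1 − 2g}`. -/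
def aHatSet (g p n : ℕ) : Set (Equiv.Perm ℤ) :=
  {π | IsPermOn π (posSet n) ∧ cyclesOn π (posSet n) = p ∧
    cyclesOn (π⁻¹ * gammaZ n) (posSet n) + p + 2 * g = n + 1}

/-- `b̂_{k,p}(n)`. -/
def bHatSet (k p n : ℕ) : Set (Equiv.Perm ℤ) :=
  {τ₁ | IsPermOn τ₁ (pmSet n) ∧ cyclesOn τ₁ (pmSet n) = 2 * p ∧
    cyclesOn (gammaTildeZ n * τ₁) (pmSet n) + 2 * p + 2 * k = 2 * n + 2 ∧
    tau0 n * τ₁ * tau0 n = τ₁⁻¹ ∧ (∀ a ∈ pmSet n, (tau0 n * τ₁) a ≠ a) ∧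
    ∃ a ∈ posSet n, -(τ₁ a) ∈ posSet n}

/-- `ÑC₂^{δ,p}(2n, −2n)`. -/
def ncDelta2Tilde (p n : ℕ) : Set (Equiv.Perm ℤ) :=
  {π | π ∈ ncDelta2 (2 * n) ∧ (∀ a ∈ WSet n, π a ∈ BSet n) ∧
    cyclesOn (π⁻¹ * gammaTildeZ (2 * n)) (BSet n) = 2 * p}

/-- `ÑC₂^{T,p}(2n)`. -/
def ncT2Tilde (p n : ℕ) : Set (Equiv.Perm ℤ) :=
  {π | ∃ u v : ℤ, 1 ≤ u ∧ u < v ∧ v < (2 * n : ℤ) ∧ Odd (v - u) ∧ π ∈ ncT2uv (2 * n) u v ∧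
    (∀ a ∈ posSet (2 * n), Even a → Odd (π a)) ∧
    cyclesOn (π⁻¹ * gammaZ (2 * n)) (oddPosSet n) = p}

/-- `ÑC₂^{K,p}(2n)`. -/
def ncK2Tilde (p n : ℕ) : Set (Equiv.Perm ℤ) :=
  {π | ∃ u v : ℤ, 1 ≤ u ∧ u < v ∧ v < (2 * n : ℤ) ∧ Even (v - u) ∧ π ∈ ncK2uv (2 * n) u v ∧
    (∀ a ∈ WSet n, π a ∈ BSet n) ∧
    cyclesOn (π⁻¹ * gammaTildeZ (2 * n)) (BSet n) = 2 * p}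

/-- `NC^{T,p}(n)` (non-crossing annular permutations, toroidal case). -/
def ncTPerm (p n : ℕ) : Set (Equiv.Perm ℤ) :=
  {π | ∃ u v : ℤ, 1 ≤ u ∧ u < v ∧ v < (n : ℤ) ∧ IsPermOn π (posSet n) ∧
    IsNoncrossingOn π (gammaUV n u v) (posSet n) ∧ π⁻¹ u = v ∧
    cyclesOn π (posSet n) = p ∧
    ∀ a : ℤ, 1 ≤ a → a < u → π⁻¹ a ∈ posSet n ∧ ¬(u ≤ π⁻¹ a ∧ π⁻¹ a ≤ v)}

/-- `NC^{δ,p}(n, −n)` (symmetric non-crossing annular permutations). -/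
def ncDeltaPerm (p n : ℕ) : Set (Equiv.Perm ℤ) :=
  {π | IsPermOn π (pmSet n) ∧ IsNoncrossingOn π (gammaTildeZ n) (pmSet n) ∧
    IsDeltaOn π (pmSet n) ∧ cyclesOn π (pmSet n) = 2 * p}

/-- `NC^{K,p}(n)` (non-crossing annular permutations, Klein bottle case). -/
def ncKPerm (p n : ℕ) : Set (Equiv.Perm ℤ) :=
  {π | ∃ u v : ℤ, 1 ≤ u ∧ u < v ∧ v < (n : ℤ) ∧ IsPermOn π (pmSet n) ∧
    IsNoncrossingOn π (gammaTildeUV n u v) (pmSet n) ∧ IsDeltaOn π (pmSet n) ∧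
    π u = -v ∧ cyclesOn π (pmSet n) = 2 * p ∧
    ∀ a : ℤ, 1 ≤ a → a < u → π⁻¹ a ∈ posSet n}


/-! ### Pointwise descriptions of the basic permutations -/

/-- The definitions coerce `List.range n` to a list of integers through the list monad. -/
theorem range_coe_map {β : Type*} (f : ℤ → β) (n : ℕ) :
    List.map f (do let a ← List.range n; pure (a : ℤ)) =
      (List.range n).map (fun i : ℕ => f (i : ℤ)) := by
  induction List.range n with
  | nil => rfl
  | cons x l ih => simp_all

theorem tau0_apply (n : ℕ) (a : ℤ) :
    tau0 n a = if -(n : ℤ) ≤ a ∧ a ≤ n then -a else a := by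
  unfold tau0
  rw [range_coe_map]
  induction n generalizing a with
  | zero =>
    simp only [List.range_zero, List.map_nil, List.prod_nil, Equiv.Perm.coe_one, id]
    split_ifs with h
    · push_cast at h; omega
    · rfl
  | succ m ih =>
    rw [List.range_succ, List.map_append, List.prod_append]
    simp only [List.map_cons, List.map_nil, List.prod_cons, List.prod_nil, mul_one,
      Equiv.Perm.mul_apply, ih, Equiv.swap_apply_def]
    push_cast
    split_ifs <;> omega

theorem tau2_aux (m : ℕ) (a : ℤ) :
    ((List.range m).map fun i : ℕ => Equiv.swap (-((i : ℤ) + 1)) ((i : ℤ) + 2)).prod a =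
      if (2 ≤ a ∧ a ≤ m + 1) ∨ (-(m : ℤ) ≤ a ∧ a ≤ -1) then 1 - a else a := by
  induction m generalizing a with
  | zero =>
    simp only [List.range_zero, List.map_nil, List.prod_nil, Equiv.Perm.coe_one, id]
    split_ifs with h
    · push_cast at h; omega
    · rfl
  | succ m ih =>
    rw [List.range_succ, List.map_append, List.prod_append]
    simp only [List.map_cons, List.map_nil, List.prod_cons, List.prod_nil, mul_one,
      Equiv.Perm.mul_apply, ih, Equiv.swap_apply_def]
    push_cast
    split_ifs <;> omega

theorem tau2_apply (n : ℕ) (hn : 1 ≤ n) (a : ℤ) :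
    tau2 n a = if a = 1 then -(n : ℤ) else if a = -(n : ℤ) then 1 else
      if -(n : ℤ) ≤ a ∧ a ≤ n ∧ a ≠ 0 then 1 - a else a := by
  unfold tau2
  rw [range_coe_map, Equiv.Perm.mul_apply, tau2_aux, Equiv.swap_apply_def]
  push_cast [Nat.cast_sub hn]
  split_ifs <;> omega

theorem formPerm_range_apply (c : ℤ) (n : ℕ) (a : ℤ) :
    ((List.range n).map fun i : ℕ => ((i : ℤ) + c)).formPerm a =
      if c ≤ a ∧ a + 1 < c + n then a + 1 else if a + 1 = c + n ∧ c ≤ a then c else a := by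
  set L := (List.range n).map fun i : ℕ => ((i : ℤ) + c) with hL
  have hnd : L.Nodup := by
    apply List.Nodup.map _ List.nodup_range
    intro x y h
    simpa using h
  have hlen : L.length = n := by simp [hL]
  by_cases h : c ≤ a ∧ a < c + n
  · obtain ⟨i, hi⟩ := Int.eq_ofNat_of_zero_le (show 0 ≤ a - c by omega)
    have hin : i < L.length := by omega
    have key := List.formPerm_apply_getElem L hnd i hin
    have e1 : L[i] = a := by simp [hL]; omega
    rw [e1] at key
    rw [key]
    by_cases h2 : i + 1 < n
    · have e2 : (i + 1) % L.length = i + 1 := Nat.mod_eq_of_lt (by omega)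
      simp only [e2]
      rw [if_pos (by omega)]
      simp [hL]; omega
    · have e2 : (i + 1) % L.length = 0 := by
        rw [show i + 1 = L.length by omega, Nat.mod_self]
      simp only [e2]
      rw [if_neg (by omega), if_pos (by omega)]
      simp [hL]
  · rw [List.formPerm_apply_of_notMem, if_neg (by omega), if_neg (by omega)]
    intro hm
    simp only [hL, List.mem_map, List.mem_range] at hm
    omega

theorem gammaTildeZ_apply (n : ℕ) (a : ℤ) :
    gammaTildeZ n a =
      if 1 ≤ a ∧ a < n then a + 1 else if 1 ≤ a ∧ a = n then 1 else
      if -(n : ℤ) ≤ a ∧ a < -1 then a + 1 else if -(n : ℤ) ≤ a ∧ a = -1 then -(n : ℤ) else a := by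
  unfold gammaTildeZ gammaZ
  rw [range_coe_map, range_coe_map]
  have h := formPerm_range_apply (-(n : ℤ)) n a
  simp only [← sub_eq_add_neg] at h
  rw [Equiv.Perm.mul_apply, h, formPerm_range_apply]
  split_ifs <;> omega

theorem gammaTildeZ_eq (n : ℕ) (hn : 1 ≤ n) : gammaTildeZ n = tau2 n * tau0 n := by
  ext a
  rw [Equiv.Perm.mul_apply, tau0_apply, tau2_apply n hn, gammaTildeZ_apply]
  split_ifs <;> omega

theorem tau0_sq (n : ℕ) : tau0 n * tau0 n = 1 := by
  ext a
  simp only [Equiv.Perm.mul_apply, tau0_apply, Equiv.Perm.coe_one, id]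
  split_ifs <;> omega

theorem tau2_sq (n : ℕ) (hn : 1 ≤ n) : tau2 n * tau2 n = 1 := by
  ext a
  simp only [Equiv.Perm.mul_apply, tau2_apply n hn, Equiv.Perm.coe_one, id]
  split_ifs <;> omega

theorem mem_pmSet {n : ℕ} {a : ℤ} : a ∈ pmSet n ↔ (-(n : ℤ) ≤ a ∧ a ≤ n) ∧ a ≠ 0 := by
  simp [pmSet]

theorem mem_posSet {n : ℕ} {a : ℤ} : a ∈ posSet n ↔ 1 ≤ a ∧ a ≤ n := by
  simp [posSet]

theorem card_pmSet (n : ℕ) : (pmSet n).card = 2 * n := by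
  unfold pmSet
  rw [Finset.card_sdiff_of_subset (by simp)]
  simp
  omega

theorem tau0_mem {n : ℕ} {a : ℤ} (h : a ∈ pmSet n) : tau0 n a = -a := by
  rw [mem_pmSet] at h
  rw [tau0_apply, if_pos h.1]

theorem tau0_notMem {n : ℕ} {a : ℤ} (h : a ∉ pmSet n) : tau0 n a = a := by
  rw [mem_pmSet] at h
  rw [tau0_apply]
  split_ifs <;> omega

theorem neg_mem_pmSet {n : ℕ} {a : ℤ} : -a ∈ pmSet n ↔ a ∈ pmSet n := by
  simp only [mem_pmSet]; omega

/-! ### Counting cycles -/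

theorem cyclesOn_congr {α : Type*} (g σ σ' : Equiv.Perm α) (S T : Finset α)
    (hST : ∀ a, a ∈ S ↔ g a ∈ T)
    (h : ∀ a b, σ'.SameCycle (g a) (g b) ↔ σ.SameCycle a b) :
    cyclesOn σ' T = cyclesOn σ S := by
  unfold cyclesOn
  have : (fun a => {b | σ'.SameCycle a b}) '' (T : Set α) =
      (fun X : Set α => g '' X) '' ((fun a => {b | σ.SameCycle a b}) '' (S : Set α)) := by
    have hT : (T : Set α) = g '' (S : Set α) := by
      ext x
      obtain ⟨y, rfl⟩ := g.surjective x
      simp [hST]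
    rw [hT, Set.image_image, Set.image_image]
    apply Set.image_congr
    intro a _
    ext x
    obtain ⟨y, rfl⟩ := g.surjective x
    simp [h]
  rw [this]
  exact Set.ncard_image_of_injective _ g.injective.image_injective

theorem cyclesOn_pairing {α : Type*} (π : Equiv.Perm α) (S : Finset α) (h : IsPairingOn π S) :
    2 * cyclesOn π S = S.card := by
  classical
  obtain ⟨h1, h2, h3⟩ := h
  have hinv : ∀ a, π (π a) = a := fun a => by
    rw [← Equiv.Perm.mul_apply, h1, Equiv.Perm.coe_one, id]
  have hmem : ∀ a ∈ S, π a ∈ S := by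
    intro a ha
    by_contra hc
    have := h3 _ hc
    rw [hinv] at this
    exact h2 a ha this.symm
  have hz : ∀ (k : ℤ) (a : α), (π ^ k) a = a ∨ (π ^ k) a = π a := by
    intro k a
    have hsq : π ^ (2 : ℤ) = 1 := by rw [zpow_two, h1]
    rcases Int.even_or_odd' k with ⟨m, rfl | rfl⟩
    · left; rw [zpow_mul, hsq]; simp
    · right; rw [zpow_add, zpow_mul, hsq]; simp
  have hsc : ∀ a b, π.SameCycle a b ↔ b = a ∨ b = π a := by
    intro a b
    constructor
    · rintro ⟨k, rfl⟩; exact hz k a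
    · rintro (rfl | rfl)
      · exact Equiv.Perm.SameCycle.refl _ _
      · exact ⟨1, by simp⟩
  set f : α → Set α := fun a => {b | π.SameCycle a b} with hf
  have hf' : ∀ a b, f a = f b ↔ (a = b ∨ a = π b) := by
    intro a b
    constructor
    · intro hab
      have : a ∈ f b := by rw [← hab]; exact Equiv.Perm.SameCycle.refl _ _
      exact (hsc b a).1 this
    · intro hab
      have hba := (hsc b a).2 hab
      ext x
      exact ⟨fun hx => hba.trans hx, fun hx => hba.symm.trans hx⟩
  have hcard : cyclesOn π S = (S.image f).card := by
    unfold cyclesOn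
    rw [← Set.ncard_coe_finset, Finset.coe_image]
  rw [hcard, Finset.card_eq_sum_card_image f S]
  rw [Finset.sum_const_nat (m := 2), mul_comm]
  intro x hx
  obtain ⟨a, ha, rfl⟩ := Finset.mem_image.1 hx
  have : S.filter (fun b => f b = f a) = {a, π a} := by
    ext b
    simp only [Finset.mem_filter, hf', Finset.mem_insert, Finset.mem_singleton]
    constructor
    · exact fun h => h.2
    · rintro (rfl | rfl)
      · exact ⟨ha, Or.inl rfl⟩
      · exact ⟨hmem a ha, Or.inr rfl⟩
  rw [this, Finset.card_pair (h2 a ha).symm]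

theorem gammaTildeZ_sameCycle_pos (n : ℕ) (a : ℤ) (h1 : 1 ≤ a) (h2 : a ≤ n) :
    (gammaTildeZ n).SameCycle 1 a := by
  obtain ⟨k, rfl⟩ : ∃ k : ℕ, a = k + 1 := ⟨(a - 1).toNat, by omega⟩
  induction k with
  | zero => simp [Equiv.Perm.SameCycle.refl]
  | succ k ih =>
    have := ih (by omega) (by push_cast at h2; omega)
    have e : gammaTildeZ n ((k : ℤ) + 1) = ((k + 1 : ℕ) : ℤ) + 1 := by
      rw [gammaTildeZ_apply, if_pos (by push_cast at h2; omega)]; push_cast; rfl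
    rw [← e]
    exact Equiv.Perm.sameCycle_apply_right.2 this

theorem gammaTildeZ_sameCycle_neg (n : ℕ) (a : ℤ) (h1 : -(n : ℤ) ≤ a) (h2 : a ≤ -1) :
    (gammaTildeZ n).SameCycle (-(n : ℤ)) a := by
  obtain ⟨k, rfl⟩ : ∃ k : ℕ, a = k - n := ⟨(a + n).toNat, by omega⟩
  induction k with
  | zero => simp [Equiv.Perm.SameCycle.refl]
  | succ k ih =>
    have := ih (by omega) (by push_cast at h2; omega)
    have e : gammaTildeZ n ((k : ℤ) - n) = ((k + 1 : ℕ) : ℤ) - n := by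
      rw [gammaTildeZ_apply, if_neg (by push_cast at h2; omega), if_neg (by push_cast at h2; omega),
        if_pos (by push_cast at h2; omega)]
      push_cast; ring
    rw [← e]
    exact Equiv.Perm.sameCycle_apply_right.2 this

theorem gammaTildeZ_pos_iff (n : ℕ) (a : ℤ) : 0 < gammaTildeZ n a ↔ 0 < a := by
  rw [gammaTildeZ_apply]
  split_ifs <;> omega

theorem gammaTildeZ_not_sameCycle (n : ℕ) (a b : ℤ) (h : (gammaTildeZ n).SameCycle a b) :
    0 < a ↔ 0 < b := by
  obtain ⟨k, rfl⟩ := h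
  induction k using Int.induction_on with
  | zero => simp
  | succ k ih => rw [ih, add_comm, zpow_add, Equiv.Perm.mul_apply, zpow_one, gammaTildeZ_pos_iff]
  | pred k ih =>
    rw [ih, ← gammaTildeZ_pos_iff n ((gammaTildeZ n ^ (-(k : ℤ) - 1)) a), ← Equiv.Perm.mul_apply,
      ← zpow_one_add]
    ring_nf

theorem cyclesOn_gammaTildeZ (n : ℕ) (hn : 1 ≤ n) : cyclesOn (gammaTildeZ n) (pmSet n) = 2 := by
  unfold cyclesOn
  set f : ℤ → Set ℤ := fun a => {b | (gammaTildeZ n).SameCycle a b} with hf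
  have hfe : ∀ a b, (gammaTildeZ n).SameCycle a b → f a = f b := by
    intro a b hab
    ext x
    exact ⟨fun hx => hab.symm.trans hx, fun hx => hab.trans hx⟩
  have : f '' (pmSet n : Set ℤ) = {f 1, f (-(n : ℤ))} := by
    ext x
    simp only [Set.mem_image, Finset.mem_coe, mem_pmSet, Set.mem_insert_iff,
      Set.mem_singleton_iff]
    constructor
    · rintro ⟨a, ha, rfl⟩
      rcases lt_or_gt_of_ne ha.2 with h | h
      · right; exact (hfe _ _ (gammaTildeZ_sameCycle_neg n a (by omega) (by omega))).symm
      · left; exact (hfe _ _ (gammaTildeZ_sameCycle_pos n a (by omega) (by omega))).symm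
    · rintro (rfl | rfl)
      · exact ⟨1, by omega, rfl⟩
      · exact ⟨-(n : ℤ), by omega, rfl⟩
  rw [this, Set.ncard_pair]
  intro heq
  have h1 : (1 : ℤ) ∈ f (-(n : ℤ)) := by rw [← heq]; exact Equiv.Perm.SameCycle.refl _ _
  have := gammaTildeZ_not_sameCycle n _ _ h1
  omega

/-- Cycles of `π⁻¹ γ̃` and of `τ₂ τ₁` correspond under `τ₀`, where `π = τ₁ τ₀`. -/
theorem cyclesOn_conj (n : ℕ) (hn : 1 ≤ n) (τ : Equiv.Perm ℤ) (hτ : τ * τ = 1)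
    (S T : Finset ℤ) (hST : ∀ a, a ∈ S ↔ tau0 n a ∈ T) :
    cyclesOn ((τ * tau0 n)⁻¹ * gammaTildeZ n) T = cyclesOn (tau2 n * τ) S := by
  have h0 : (tau0 n)⁻¹ = tau0 n := inv_eq_of_mul_eq_one_left (tau0_sq n)
  have h2 : (tau2 n)⁻¹ = tau2 n := inv_eq_of_mul_eq_one_left (tau2_sq n hn)
  have ht : τ⁻¹ = τ := inv_eq_of_mul_eq_one_left hτ
  have e : (τ * tau0 n)⁻¹ * gammaTildeZ n = tau0 n * (tau2 n * τ)⁻¹ * (tau0 n)⁻¹ := by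
    rw [gammaTildeZ_eq n hn, mul_inv_rev, mul_inv_rev, h0, h2, ht]
    simp only [mul_assoc]
  rw [e]
  apply cyclesOn_congr (tau0 n) _ _ _ _ hST
  intro a b
  rw [Equiv.Perm.sameCycle_conj, Equiv.Perm.sameCycle_inv]
  simp

theorem mem_B_iff (n : ℕ) (a : ℤ) : a ∈ BSet n ↔ tau0 (2 * n) a ∈ WSet n := by
  by_cases h : a ∈ pmSet (2 * n)
  · rw [tau0_mem h]
    simp only [BSet, WSet, Finset.mem_filter, neg_mem_pmSet, h, true_and, 
      Int.odd_iff, Int.even_iff, Int.neg_emod_two]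
    omega
  · rw [tau0_notMem h]
    simp [BSet, WSet, h]

theorem mem_W_iff (n : ℕ) (a : ℤ) : a ∈ WSet n ↔ tau0 (2 * n) a ∈ BSet n := by
  rw [mem_B_iff, ← Equiv.Perm.mul_apply, tau0_sq]
  simp

/-- The core equivalence. -/
theorem mem_bTilde_iff (n p : ℕ) (hn : 1 ≤ n) (τ : Equiv.Perm ℤ) :
    τ ∈ bTildeSet 1 p n ↔ τ * tau0 (2 * n) ∈ ncDelta2Tilde p n := by
  have hN : 1 ≤ 2 * n := by omega
  have hBW : ∀ a, a ∈ WSet n ↔ tau0 (2 * n) a ∈ BSet n := mem_W_iff n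
  have hWB : ∀ a, a ∈ BSet n ↔ tau0 (2 * n) a ∈ WSet n := mem_B_iff n
  have hpm : ∀ a, a ∈ pmSet (2 * n) ↔ tau0 (2 * n) a ∈ pmSet (2 * n) := by
    intro a
    by_cases h : a ∈ pmSet (2 * n)
    · rw [tau0_mem h, neg_mem_pmSet]
    · rw [tau0_notMem h]
  unfold bTildeSet ncDelta2Tilde bSet ncDelta2
  simp only [Set.mem_ofPred_eq]
  set N := 2 * n with hNdef
  have h00 : ∀ a, tau0 N (tau0 N a) = a := fun a => by
    rw [← Equiv.Perm.mul_apply, tau0_sq]; rfl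
  have hcol : (∀ a ∈ BSet n, τ a ∈ BSet n) ↔ ∀ a ∈ WSet n, (τ * tau0 N) a ∈ BSet n := by
    constructor
    · intro h a ha
      exact h _ ((hBW a).1 ha)
    · intro h a ha
      have := h _ ((hWB a).1 ha)
      rwa [Equiv.Perm.mul_apply, h00] at this
  rw [hcol]
  constructor
  · rintro ⟨⟨hpair, hcyc, hcomm, hfix, a, ha, hta⟩, hc, hcount⟩
    obtain ⟨hsq, hnf, hout⟩ := hpair
    have hππ : (τ * tau0 N) * (τ * tau0 N) = 1 := by
      rw [mul_assoc, ← mul_assoc (tau0 N), hcomm, mul_assoc τ (tau0 N), tau0_sq, mul_one, hsq]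
    have hpair' : IsPairingOn (τ * tau0 N) (pmSet N) := by
      refine ⟨hππ, fun x hx => ?_, fun x hx => ?_⟩
      · rw [← hcomm]; exact hfix x hx
      · rw [Equiv.Perm.mul_apply, tau0_notMem hx, hout x hx]
    have hinv : (τ * tau0 N)⁻¹ = τ * tau0 N := inv_eq_of_mul_eq_one_left hππ
    have hττ : ∀ x, τ (τ x) = x := fun x => by rw [← Equiv.Perm.mul_apply, hsq]; rfl
    have hmem : ∀ x, x ∈ pmSet N → τ x ∈ pmSet N := by
      intro x hx
      by_contra hcon
      have := hout _ hcon
      rw [hττ] at this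
      exact hnf x hx this.symm
    have hcomm' : ∀ x, τ (-x) = -(τ x) := by
      intro x
      by_cases hx : x ∈ pmSet N
      · have := congrArg (fun σ : Equiv.Perm ℤ => σ x) hcomm
        simp only [Equiv.Perm.mul_apply] at this
        rw [tau0_mem hx, tau0_mem (hmem x hx)] at this
        exact this.symm
      · rw [hout x hx, hout (-x) (by rwa [neg_mem_pmSet])]
    refine ⟨⟨hpair', ⟨?_, ?_⟩, ?_, ?_⟩, hc, ?_⟩
    · -- transitivity
      set G := Subgroup.closure ({τ * tau0 N, gammaTildeZ N} : Set (Equiv.Perm ℤ)) with hG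
      have hπG : τ * tau0 N ∈ G := Subgroup.subset_closure (by simp)
      have hγG : gammaTildeZ N ∈ G := Subgroup.subset_closure (by simp)
      rw [mem_posSet] at ha hta
      have haN : a ∈ pmSet N := by rw [mem_pmSet]; omega
      have hπa : (τ * tau0 N) a = -(τ a) := by
        rw [Equiv.Perm.mul_apply, tau0_mem haN, hcomm']
      -- everything is reachable from 1
      have hreach : ∀ x ∈ pmSet N, ∃ σ ∈ G, σ 1 = x := by
        intro x hx
        rw [mem_pmSet] at hx
        rcases lt_or_gt_of_ne hx.2 with h | h
        · obtain ⟨k, hk⟩ := gammaTildeZ_sameCycle_pos N a (by omega) (by omega)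
          have hs := (gammaTildeZ_sameCycle_neg N (-(τ a)) (by omega) (by omega)).symm.trans
            (gammaTildeZ_sameCycle_neg N x (by omega) (by omega))
          obtain ⟨l, hl⟩ := hs
          refine ⟨gammaTildeZ N ^ l * (τ * tau0 N) * gammaTildeZ N ^ k,
            G.mul_mem (G.mul_mem (G.zpow_mem hγG l) hπG) (G.zpow_mem hγG k), ?_⟩
          rw [Equiv.Perm.mul_apply, hk, Equiv.Perm.mul_apply, hπa, hl]
        · obtain ⟨k, hk⟩ := gammaTildeZ_sameCycle_pos N x (by omega) (by omega)
          exact ⟨_, G.zpow_mem hγG k, hk⟩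
      intro x hx y hy
      obtain ⟨σ, hσ, hσx⟩ := hreach x hx
      obtain ⟨ρ, hρ, hρy⟩ := hreach y hy
      refine ⟨ρ * σ⁻¹, G.mul_mem hρ (G.inv_mem hσ), ?_⟩
      rw [Equiv.Perm.mul_apply, ← hσx, ← Equiv.Perm.mul_apply σ⁻¹, inv_mul_cancel]
      exact hρy
    · rw [cyclesOn_conj N hN τ hsq _ _ hpm, cyclesOn_gammaTildeZ N hN]
      have h2 := cyclesOn_pairing _ _ hpair'
      rw [card_pmSet] at h2 ⊢
      omega
    · rintro r hr ⟨h1, -⟩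
      rw [Equiv.Perm.mul_apply, tau0_mem hr] at h1
      exact hnf (-r) (neg_mem_pmSet.2 hr) h1
    · intro x
      rw [hinv, Equiv.Perm.mul_apply, Equiv.Perm.mul_apply, ← hcomm']
      by_cases hx : x ∈ pmSet N
      · rw [tau0_mem hx, tau0_mem (neg_mem_pmSet.2 hx)]
      · rw [tau0_notMem hx, tau0_notMem (by rwa [neg_mem_pmSet])]
    · rw [cyclesOn_conj N hN τ hsq _ _ hBW, hcount]
  · rintro ⟨⟨hpair', ⟨htrans, hcyc⟩, hd1, hd2⟩, hc, hcount⟩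
    have hpp := hpair'
    obtain ⟨hππ, hnf, hout⟩ := hpair'
    have hinv : (τ * tau0 N)⁻¹ = τ * tau0 N := inv_eq_of_mul_eq_one_left hππ
    rw [hinv] at hd2
    have hππ' : ∀ x, (τ * tau0 N) ((τ * tau0 N) x) = x := fun x => by
      rw [← Equiv.Perm.mul_apply, hππ]; rfl
    have hmem : ∀ x, x ∈ pmSet N → (τ * tau0 N) x ∈ pmSet N := by
      intro x hx
      by_contra hcon
      have := hout _ hcon
      rw [hππ'] at this
      exact hnf x hx this.symm
    have hτ : ∀ x, τ x = (τ * tau0 N) (tau0 N x) := fun x => by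
      rw [Equiv.Perm.mul_apply, h00]
    have hcommP : tau0 N * (τ * tau0 N) = (τ * tau0 N) * tau0 N := by
      ext x
      rw [Equiv.Perm.mul_apply, Equiv.Perm.mul_apply (τ * tau0 N)]
      by_cases hx : x ∈ pmSet N
      · rw [tau0_mem hx, tau0_mem (hmem x hx), hd2]
      · rw [tau0_notMem hx, hout x hx, tau0_notMem hx]
    have hcomm : tau0 N * τ = τ * tau0 N := by
      have := congrArg (fun σ => σ * tau0 N) hcommP
      simpa only [mul_assoc, tau0_sq, mul_one] using this
    have hsq : τ * τ = 1 := by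
      have h := hππ
      rwa [mul_assoc, ← mul_assoc (tau0 N), hcomm, mul_assoc τ (tau0 N), tau0_sq, mul_one] at h
    refine ⟨⟨⟨hsq, ?_, ?_⟩, ?_, hcomm, ?_, ?_⟩, hc, ?_⟩
    · intro x hx hfx
      rw [hτ, tau0_mem hx] at hfx
      refine hd1 x hx ⟨?_, hfx⟩
      rw [hd2] at hfx
      omega
    · intro x hx
      rw [hτ, tau0_notMem hx, hout x hx]
    · rw [cyclesOn_conj N hN τ hsq _ _ hpm, cyclesOn_gammaTildeZ N hN] at hcyc
      have h2 := cyclesOn_pairing _ _ hpp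
      rw [card_pmSet] at h2 hcyc
      omega
    · rw [hcomm]; exact hnf
    · by_contra hno
      push Not at hno
      -- the positive elements are then invariant
      have hposπ : ∀ x, x ∈ posSet N → (τ * tau0 N) x ∈ posSet N := by
        intro x hx
        have hx' := hx
        have h1 := hno x hx
        rw [mem_posSet] at hx
        have hxm : x ∈ pmSet N := by rw [mem_pmSet]; omega
        have h2 := hmem x hxm
        rw [hτ, tau0_mem hxm, hd2, mem_posSet] at h1
        rw [mem_pmSet] at h2
        rw [mem_posSet]
        omega
      have hposγ : ∀ x, x ∈ posSet N → gammaTildeZ N x ∈ posSet N := by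
        intro x hx
        rw [mem_posSet] at hx ⊢
        rw [gammaTildeZ_apply]
        split_ifs <;> omega
      have hiff : ∀ σ : Equiv.Perm ℤ, (∀ x, x ∈ posSet N → σ x ∈ posSet N) →
          ∀ x, σ x ∈ posSet N ↔ x ∈ posSet N := by
        intro σ hσ x
        refine ⟨fun hx => ?_, hσ x⟩
        have himg : (posSet N).image σ = posSet N := by
          apply Finset.eq_of_subset_of_card_le
          · intro y hy
            obtain ⟨z, hz, rfl⟩ := Finset.mem_image.1 hy
            exact hσ z hz
          · rw [Finset.card_image_of_injective _ σ.injective]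
        rw [← himg] at hx
        obtain ⟨z, hz, hzx⟩ := Finset.mem_image.1 hx
        rwa [← σ.injective hzx]
      obtain ⟨σ, hσ, hσ1⟩ := htrans 1 (by rw [mem_pmSet]; omega) (-1)
        (by rw [mem_pmSet]; omega)
      have hall : ∀ x, σ x ∈ posSet N ↔ x ∈ posSet N := by
        clear hσ1
        induction hσ using Subgroup.closure_induction with
        | mem y hy =>
          rcases hy with rfl | hy
          · exact hiff _ hposπ
          · rw [Set.mem_singleton_iff] at hy
            subst hy
            exact hiff _ hposγ
        | one => intro x; rfl
        | mul y z _ _ hy hz =>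
          intro x; rw [Equiv.Perm.mul_apply, hy, hz]
        | inv y _ hy =>
          intro x
          rw [← hy, ← Equiv.Perm.mul_apply, mul_inv_cancel]
          rfl
      have := hall 1
      rw [hσ1, mem_posSet, mem_posSet] at this
      omega
    · rw [← cyclesOn_conj N hN τ hsq _ _ hBW, hcount]

/-- For `n ≥ 1` and `p ≥ 1`, the map `φ̃₁ : τ₁ ↦ τ₁ ∘ τ₀` is a bijection
from `b̃_{1,p}(n)` onto `ÑC₂^{δ,p}(2n, −2n)`. -/
theorem bijection_bTilde1_ncDelta2Tilde (n p : ℕ) (hn : 1 ≤ n) (hp : 1 ≤ p) :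
    Set.BijOn (fun τ₁ => τ₁ * tau0 (2 * n)) (bTildeSet 1 p n) (ncDelta2Tilde p n) := by
  refine ⟨fun τ hτ => (mem_bTilde_iff n p hn τ).1 hτ, fun x _ y _ hxy => mul_right_cancel hxy, ?_⟩
  intro π hπ
  have e : π * tau0 (2 * n) * tau0 (2 * n) = π := by rw [mul_assoc, tau0_sq, mul_one]
  exact ⟨π * tau0 (2 * n), (mem_bTilde_iff n p hn _).2 (by rwa [e]), e⟩

end RibbonNC
end
end

section
/- Let n be a positive even integer and let π be a pairing of [n] with no crossing, i.e., there do not exist 1 ≤ u < u' < v < v' ≤ n with π(u) = v and π(u') = v'. Then #(π⁻¹γ_n) = n/2 + 1; equivalently, #(π) + #(π⁻¹γ_n) + #(γ_n) = n + 2. -/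
open Equiv MeasureTheory ProbabilityTheory

noncomputable section

namespace RibbonNC

theorem sameCycle_rel {σ : Equiv.Perm ℤ} {R : ℤ → ℤ → Prop} (hR : Equivalence R)
    (h : ∀ x, R x (σ x)) {x y : ℤ} (hxy : σ.SameCycle x y) : R x y := by
  obtain ⟨i, rfl⟩ := hxy
  induction i using Int.induction_on with
  | zero => simpa using hR.refl x
  | succ i ih =>
    have := h ((σ ^ (i : ℤ)) x)
    rw [add_comm, zpow_add, zpow_one, Equiv.Perm.mul_apply]
    exact hR.trans ih this
  | pred i ih =>
    have := h ((σ ^ (-(i : ℤ) - 1)) x)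
    rw [← Equiv.Perm.mul_apply, ← zpow_one_add] at this
    rw [show 1 + (-(i : ℤ) - 1) = -(i : ℤ) by ring] at this
    exact hR.trans ih (hR.symm this)

theorem sameCycle_equivalence (σ : Equiv.Perm ℤ) : Equivalence σ.SameCycle :=
  ⟨fun x => Equiv.Perm.SameCycle.refl σ x, fun h => h.symm, fun h g => h.trans g⟩

theorem class_eq_iff (σ : Equiv.Perm ℤ) (x y : ℤ) :
    {b | σ.SameCycle x b} = {b | σ.SameCycle y b} ↔ σ.SameCycle x y := by
  constructor
  · intro h
    have : y ∈ {b | σ.SameCycle y b} := Equiv.Perm.SameCycle.refl σ y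
    rw [← h] at this
    exact this
  · intro h
    ext b
    exact ⟨fun g => h.symm.trans g, fun g => h.trans g⟩

theorem ncard_image_eq {α β γ : Type*} [Nonempty α] (A : Set α) (f : α → β) (g : α → γ)
    (h : ∀ x ∈ A, ∀ y ∈ A, f x = f y ↔ g x = g y) : (f '' A).ncard = (g '' A).ncard := by
  have hr : ∀ z ∈ f '' A, Function.invFunOn f A z ∈ A ∧ f (Function.invFunOn f A z) = z :=
    fun z hz => ⟨Function.invFunOn_mem hz, Function.invFunOn_eq hz⟩
  have e : g '' A = (fun z => g (Function.invFunOn f A z)) '' (f '' A) := by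
    ext w
    constructor
    · rintro ⟨x, hx, rfl⟩
      refine ⟨f x, ⟨x, hx, rfl⟩, ?_⟩
      have := hr (f x) ⟨x, hx, rfl⟩
      exact (h _ this.1 _ hx).1 this.2
    · rintro ⟨z, hz, rfl⟩
      exact ⟨_, (hr z hz).1, rfl⟩
  rw [e]
  symm
  apply Set.InjOn.ncard_image
  intro z hz w hw hzw
  have := (h _ (hr z hz).1 _ (hr w hw).1).2 hzw
  rw [(hr z hz).2, (hr w hw).2] at this
  exact this

theorem step (σ : Equiv.Perm ℤ) (S : Finset ℤ) (u v : ℤ) (huv : u < v) (hu : u ∈ S) (hv : v ∈ S)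
    (hσ : ∀ x, u ≤ x → x < v → σ x = x + 1) :
    cyclesOn (Equiv.swap u v * σ) S = cyclesOn σ S + 1 := by
  set τ := Equiv.swap u v * σ with hτ
  have hτx : ∀ x, τ x = Equiv.swap u v (σ x) := fun x => rfl
  have hσuv : σ.SameCycle u v := by
    have key : ∀ k : ℕ, u + k ≤ v → σ.SameCycle u (u + k) := by
      intro k
      induction k with
      | zero => intro _; simp [Equiv.Perm.SameCycle.refl]
      | succ k ih =>
        intro hk
        push_cast at hk
        have h1 := ih (by omega)
        have h2 := hσ (u + k) (by omega) (by omega)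
        push_cast
        rw [← add_assoc, ← h2]
        exact Equiv.Perm.sameCycle_apply_right.2 h1
    have := key (v - u).toNat (by omega)
    rwa [show u + ((v - u).toNat : ℤ) = v by omega] at this
  have hτσ : ∀ x y, τ.SameCycle x y → σ.SameCycle x y := by
    intro x y h
    refine sameCycle_rel (sameCycle_equivalence σ) ?_ h
    intro x
    have h0 : σ.SameCycle x (σ x) := Equiv.Perm.sameCycle_apply_right.2 (Equiv.Perm.SameCycle.refl _ _)
    rw [hτx]
    by_cases h1 : σ x = u
    · rw [h1, Equiv.swap_apply_left]; rw [h1] at h0; exact h0.trans hσuv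
    by_cases h2 : σ x = v
    · rw [h2, Equiv.swap_apply_right]; rw [h2] at h0; exact h0.trans hσuv.symm
    rw [Equiv.swap_apply_of_ne_of_ne h1 h2]; exact h0
  let r : ℤ → ℤ := fun x => if u ≤ x ∧ x < v then v else x
  have hpre : ∀ x, u < σ x → σ x ≤ v → u ≤ x ∧ x < v := by
    intro x h1 h2
    have h3 := hσ (σ x - 1) (by omega) (by omega)
    rw [sub_add_cancel] at h3
    have := σ.injective h3
    omega
  have hstτ : ∀ x, τ.SameCycle x (τ x) := fun x =>
    Equiv.Perm.sameCycle_apply_right.2 (Equiv.Perm.SameCycle.refl _ _)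
  have hr : ∀ x y, σ.SameCycle x y → τ.SameCycle (r x) (r y) := by
    intro x y h
    refine sameCycle_rel (R := fun x y => τ.SameCycle (r x) (r y))
      ⟨fun x => Equiv.Perm.SameCycle.refl _ _, fun h => h.symm, fun h g => h.trans g⟩ ?_ h
    intro x
    by_cases hx : u ≤ x ∧ x < v
    · have h1 : r x = v := if_pos hx
      have h2 : r (σ x) = v := by
        rw [hσ x hx.1 hx.2]
        simp only [r]
        split_ifs <;> omega
      rw [h1, h2]
    · have h1 : r x = x := if_neg hx
      have h3 : r (σ x) = τ x := by
        rw [hτx]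
        by_cases h4 : σ x = u
        · rw [h4, Equiv.swap_apply_left]; exact if_pos ⟨le_refl _, huv⟩
        · have h5 : ¬ (u < σ x ∧ σ x ≤ v) := fun h => hx (hpre x h.1 h.2)
          rw [Equiv.swap_apply_of_ne_of_ne h4 (by omega)]
          exact if_neg (by omega)
      rw [h1, h3]; exact hstτ x
  -- the block `[u, v)` is a single orbit of `τ`
  have hC : ∀ x, u ≤ x → x < v → τ.SameCycle u x := by
    have key : ∀ k : ℕ, u + k < v → τ.SameCycle u (u + k) := by
      intro k
      induction k with
      | zero => intro _; simp [Equiv.Perm.SameCycle.refl]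
      | succ k ih =>
        intro hk
        push_cast at hk
        have h1 := ih (by omega)
        have h2 := hσ (u + k) (by omega) (by omega)
        have h3 : τ (u + k) = u + k + 1 := by
          rw [hτx, h2, Equiv.swap_apply_of_ne_of_ne (by omega) (by omega)]
        push_cast
        rw [← add_assoc, ← h3]
        exact Equiv.Perm.sameCycle_apply_right.2 h1
    intro x h1 h2
    have := key (x - u).toNat (by omega)
    rwa [show u + ((x - u).toNat : ℤ) = x by omega] at this
  have hC' : ∀ x y, τ.SameCycle x y → ((u ≤ x ∧ x < v) ↔ (u ≤ y ∧ y < v)) := by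
    intro x y h
    refine sameCycle_rel (R := fun x y => ((u ≤ x ∧ x < v) ↔ (u ≤ y ∧ y < v)))
      ⟨fun x => Iff.rfl, fun h => h.symm, fun h g => h.trans g⟩ ?_ h
    intro x
    rw [hτx]
    constructor
    · rintro ⟨h1, h2⟩
      rw [hσ x h1 h2]
      by_cases h3 : x + 1 = v
      · rw [h3, Equiv.swap_apply_right]; omega
      · rw [Equiv.swap_apply_of_ne_of_ne (by omega) h3]; omega
    · intro h
      by_cases h1 : σ x = u
      · rw [h1, Equiv.swap_apply_left] at h; omega
      by_cases h2 : σ x = v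
      · exact hpre x (by omega) (by omega)
      rw [Equiv.swap_apply_of_ne_of_ne h1 h2] at h
      exact hpre x (by omega) (by omega)
  unfold cyclesOn
  set A : Set ℤ := {x | x ∈ S ∧ ¬ (u ≤ x ∧ x < v)} with hA
  have hAf : A.Finite := S.finite_toSet.subset (fun x hx => hx.1)
  have e1 : (fun a => {b | σ.SameCycle a b}) '' (S : Set ℤ) =
      (fun a => {b | σ.SameCycle a b}) '' A := by
    ext w
    constructor
    · rintro ⟨x, hx, rfl⟩
      by_cases h : u ≤ x ∧ x < v
      · refine ⟨v, ⟨hv, by omega⟩, ?_⟩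
        refine (class_eq_iff σ v x).2 ?_
        exact hσuv.symm.trans (hτσ _ _ (hC x h.1 h.2))
      · exact ⟨x, ⟨hx, h⟩, rfl⟩
    · rintro ⟨x, hx, rfl⟩
      exact ⟨x, hx.1, rfl⟩
  have e2 : (fun a => {b | τ.SameCycle a b}) '' (S : Set ℤ) =
      insert {b | τ.SameCycle u b} ((fun a => {b | τ.SameCycle a b}) '' A) := by
    ext w
    constructor
    · rintro ⟨x, hx, rfl⟩
      by_cases h : u ≤ x ∧ x < v
      · left
        exact (class_eq_iff τ x u).2 (hC x h.1 h.2).symm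
      · right
        exact ⟨x, ⟨hx, h⟩, rfl⟩
    · rintro (rfl | ⟨x, hx, rfl⟩)
      · exact ⟨u, hu, rfl⟩
      · exact ⟨x, hx.1, rfl⟩
  rw [e1, e2, Set.ncard_insert_of_notMem _ (hAf.image _)]
  · congr 1
    apply ncard_image_eq
    intro x hx y hy
    rw [class_eq_iff, class_eq_iff]
    refine ⟨hτσ x y, fun h => ?_⟩
    have := hr x y h
    have h1 : r x = x := if_neg hx.2
    have h2 : r y = y := if_neg hy.2
    rwa [h1, h2] at this
  · rintro ⟨x, hx, h⟩
    have := hC' _ _ ((class_eq_iff τ x u).1 h)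
    exact hx.2 (this.2 ⟨le_refl _, huv⟩)

theorem gammaZ_apply (n : ℕ) (x : ℤ) (h1 : 1 ≤ x) (h2 : x < n) : gammaZ n x = x + 1 := by
  have hg : gammaZ n = ((List.range n).map (fun i : ℕ => ((i : ℤ) + 1))).formPerm := by
    unfold gammaZ
    congr 1
    simp [← List.map_eq_flatMap, Function.comp_def]
  rw [hg]
  set l := (List.range n).map (fun i : ℕ => ((i : ℤ) + 1)) with hl
  have hnd : l.Nodup := by
    refine List.Nodup.map ?_ List.nodup_range
    intro a b h
    simpa using h
  obtain ⟨k, rfl⟩ : ∃ k : ℕ, x = k + 1 := ⟨(x - 1).toNat, by omega⟩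
  have hk : k + 1 < l.length := by simp [hl]; omega
  have := List.formPerm_apply_lt_getElem l hnd k hk
  simpa [hl] using this

theorem gamma_one (n : ℕ) (hn : 0 < n) : cyclesOn (gammaZ n) (posSet n) = 1 := by
  have key : ∀ k : ℕ, k < n → (gammaZ n).SameCycle 1 (k + 1) := by
    intro k
    induction k with
    | zero => intro _; simp [Equiv.Perm.SameCycle.refl]
    | succ k ih =>
      intro hk
      have h1 := ih (by omega)
      have h2 := gammaZ_apply n (k + 1) (by omega) (by omega)
      push_cast
      rw [← h2]
      exact Equiv.Perm.sameCycle_apply_right.2 h1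
  unfold cyclesOn
  rw [Set.ncard_eq_one]
  refine ⟨{b | (gammaZ n).SameCycle 1 b}, ?_⟩
  ext w
  simp only [Set.mem_singleton_iff]
  constructor
  · rintro ⟨x, hx, rfl⟩
    simp only [posSet, Finset.coe_Icc, Set.mem_Icc] at hx
    refine (class_eq_iff _ x 1).2 ?_
    have := key (x - 1).toNat (by omega)
    rw [show ((x - 1).toNat : ℤ) + 1 = x by omega] at this
    exact this.symm
  · rintro rfl
    refine ⟨1, ?_, rfl⟩
    simp only [posSet, Finset.coe_Icc, Set.mem_Icc]
    omega

theorem main_induction (n : ℕ) (hn : 0 < n) : ∀ (k : ℕ) (ρ : Equiv.Perm ℤ),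
    (∀ x, ρ (ρ x) = x) → (∀ x, ¬ (1 ≤ x ∧ x ≤ (n : ℤ)) → ρ x = x) →
    (∀ u u' : ℤ, u < u' → u' < ρ u → ¬ ρ u < ρ u') →
    ((posSet n).filter (fun a => a < ρ a)).card = k →
    cyclesOn (ρ * gammaZ n) (posSet n) = k + 1 := by
  intro k
  induction k with
  | zero =>
    intro ρ hinv hsupp _ hk
    have h1 : ρ = 1 := by
      rw [Finset.card_eq_zero, Finset.filter_eq_empty_iff] at hk
      have hle : ∀ x, ρ x ≤ x := by
        intro x
        by_cases hx : 1 ≤ x ∧ x ≤ (n : ℤ)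
        · exact not_lt.1 (hk (Finset.mem_Icc.2 hx))
        · exact (hsupp x hx).le
      ext x
      have h1 := hle x
      have h2 := hle (ρ x)
      rw [hinv] at h2
      simp only [Equiv.Perm.coe_one, id]
      omega
    rw [h1, one_mul, gamma_one n hn]
  | succ k ih =>
    intro ρ hinv hsupp hnc hk
    have hmem : ∀ a, a ∈ (posSet n).filter (fun a => a < ρ a) ↔ (1 ≤ a ∧ a ≤ (n : ℤ)) ∧ a < ρ a := by
      intro a; simp [posSet]
    obtain ⟨u, huP, hmin⟩ := Finset.exists_min_image ((posSet n).filter (fun a => a < ρ a))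
      (fun a => ρ a - a) (Finset.card_pos.1 (by omega))
    obtain ⟨hu, huv⟩ := (hmem u).1 huP
    set v := ρ u with hvdef
    have hρv : ρ v = u := hinv u
    have hrange : ∀ x, 1 ≤ x ∧ x ≤ (n : ℤ) → 1 ≤ ρ x ∧ ρ x ≤ (n : ℤ) := by
      intro x hx
      by_contra h
      have := hsupp _ h
      rw [hinv] at this
      rw [← this] at h
      exact h hx
    have hv := hrange u hu
    rw [← hvdef] at hv
    have hbetween : ∀ w, u < w → w < v → ρ w = w := by
      intro w h1 h2
      have hw := hrange w (by omega)
      have hwv : ρ w ≠ v := fun h => by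
        have := ρ.injective (h.trans hvdef); omega
      have hwu : ρ w ≠ u := fun h => by
        have := ρ.injective (h.trans hρv.symm); omega
      have h3 := hnc u w h1 h2
      rw [← hvdef] at h3
      rcases lt_trichotomy (ρ w) w with h4 | h4 | h4
      · exfalso
        by_cases h5 : ρ w < u
        · have := hnc (ρ w) u h5 (by rw [hinv]; exact h1)
          rw [hinv, ← hvdef] at this
          omega
        · have := hmin (ρ w) ((hmem _).2 ⟨hw, by rw [hinv]; exact h4⟩)
          simp only [hinv] at this
          omega
      · exact h4
      · exfalso
        have := hmin w ((hmem _).2 ⟨by omega, h4⟩)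
        omega
    set ρ' := Equiv.swap u v * ρ with hρ'
    have hρ'u : ρ' u = u := by
      rw [hρ', Equiv.Perm.mul_apply, ← hvdef, Equiv.swap_apply_right]
    have hρ'v : ρ' v = v := by
      rw [hρ', Equiv.Perm.mul_apply, hρv, Equiv.swap_apply_left]
    have hρ'o : ∀ x, x ≠ u → x ≠ v → ρ' x = ρ x := by
      intro x h1 h2
      rw [hρ', Equiv.Perm.mul_apply, Equiv.swap_apply_of_ne_of_ne]
      · intro h; exact h2 (ρ.injective (h.trans hρv.symm))
      · intro h; exact h1 (ρ.injective (h.trans hvdef))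
    have hcase : ∀ x, (ρ' x = x ∧ (x = u ∨ x = v)) ∨ (ρ' x = ρ x ∧ x ≠ u ∧ x ≠ v) := by
      intro x
      by_cases h1 : x = u
      · left; rw [h1]; exact ⟨hρ'u, Or.inl rfl⟩
      by_cases h2 : x = v
      · left; rw [h2]; exact ⟨hρ'v, Or.inr rfl⟩
      right; exact ⟨hρ'o x h1 h2, h1, h2⟩
    have hback : ρ = Equiv.swap u v * ρ' := by
      rw [hρ', ← mul_assoc, Equiv.swap_mul_self, one_mul]
    have hih := ih ρ' ?_ ?_ ?_ ?_
    · rw [hback, mul_assoc, step _ (posSet n) u v huv (Finset.mem_Icc.2 hu) (Finset.mem_Icc.2 hv), hih]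
      intro x h1 h2
      rw [Equiv.Perm.mul_apply, gammaZ_apply n x (by omega) (by omega)]
      rcases eq_or_ne (x + 1) v with h3 | h3
      · rw [h3, hρ'v]
      · rw [hρ'o _ (by omega) h3]
        exact hbetween _ (by omega) (by omega)
    · intro x
      rcases hcase x with ⟨h, _⟩ | ⟨h, h1, h2⟩
      · rw [h, h]
      · rw [h, hρ'o, hinv]
        · intro h; exact h2 (ρ.injective (h.trans hρv.symm))
        · intro h; exact h1 (ρ.injective (h.trans hvdef))
    · intro x hx
      rcases hcase x with ⟨h, _⟩ | ⟨h, _⟩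
      · exact h
      · rw [h]; exact hsupp x hx
    · intro a b hab hb
      rcases hcase a with ⟨h, _⟩ | ⟨h, _⟩
      · omega
      · rcases hcase b with ⟨h', _⟩ | ⟨h', _⟩
        · omega
        · rw [h, h']; rw [h] at hb; exact hnc a b hab hb
    · have : (posSet n).filter (fun a => a < ρ' a) =
          ((posSet n).filter (fun a => a < ρ a)).erase u := by
        ext a
        rw [Finset.mem_erase, hmem]
        simp only [posSet, Finset.mem_filter, Finset.mem_Icc]
        rcases hcase a with ⟨h, h1 | h1⟩ | ⟨h, h1, h2⟩
        · rw [h]; simp [h1]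
        · rw [h, h1, hρv]; simp; omega
        · rw [h]; simp [h1]
      rw [this, Finset.card_erase_of_mem huP, hk]; rfl

theorem pairing_count (n : ℕ) (π : Equiv.Perm ℤ) (hπ : IsPairingOn π (posSet n)) :
    2 * ((posSet n).filter (fun a => a < π a)).card = n ∧
    cyclesOn π (posSet n) = ((posSet n).filter (fun a => a < π a)).card := by
  obtain ⟨h1, h2, h3⟩ := hπ
  have hinv : ∀ x, π (π x) = x := fun x => by rw [← Equiv.Perm.mul_apply, h1]; rfl
  have hrange : ∀ x, x ∈ posSet n → π x ∈ posSet n := by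
    intro x hx
    by_contra h
    have := h3 _ h
    rw [hinv] at this
    rw [← this] at h
    exact h hx
  constructor
  · have e : ((posSet n).filter (fun a => ¬ a < π a)).card =
        ((posSet n).filter (fun a => a < π a)).card := by
      refine Finset.card_bij (fun a _ => π a) ?_ ?_ ?_
      · intro a ha
        rw [Finset.mem_filter] at ha ⊢
        refine ⟨hrange a ha.1, ?_⟩
        rw [hinv]
        have := h2 a ha.1
        omega
      · intro a _ b _ h; exact π.injective h
      · intro b hb
        rw [Finset.mem_filter] at hb
        refine ⟨π b, ?_, hinv b⟩
        rw [Finset.mem_filter, hinv]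
        exact ⟨hrange b hb.1, by omega⟩
    have := Finset.card_filter_add_card_filter_not (s := posSet n) (fun a => a < π a)
    have hc : (posSet n).card = n := by simp [posSet]
    omega
  · have hsc : ∀ x y, π.SameCycle x y → (x = y ∨ π x = y) := by
      intro x y h
      refine sameCycle_rel (R := fun x y => x = y ∨ π x = y) ⟨fun x => Or.inl rfl, ?_, ?_⟩
        (fun x => Or.inr rfl) h
      · rintro x y (rfl | rfl)
        · exact Or.inl rfl
        · exact Or.inr (hinv x)
      · rintro x y z (rfl | rfl) (rfl | rfl)
        · exact Or.inl rfl
        · exact Or.inr rfl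
        · exact Or.inr rfl
        · exact Or.inl (hinv x).symm
    unfold cyclesOn
    have e : (fun a => {b | π.SameCycle a b}) '' (posSet n : Set ℤ) =
        (fun a => {b | π.SameCycle a b}) '' (((posSet n).filter (fun a => a < π a) : Finset ℤ) : Set ℤ) := by
      ext w
      constructor
      · rintro ⟨x, hx, rfl⟩
        by_cases h : x < π x
        · exact ⟨x, Finset.mem_coe.2 (Finset.mem_filter.2 ⟨hx, h⟩), rfl⟩
        · refine ⟨π x, Finset.mem_coe.2 (Finset.mem_filter.2 ⟨hrange x hx, ?_⟩), ?_⟩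
          · rw [hinv]
            have := h2 x hx
            omega
          · exact (class_eq_iff π _ _).2
              (Equiv.Perm.sameCycle_apply_left.2 (Equiv.Perm.SameCycle.refl _ _))
      · rintro ⟨x, hx, rfl⟩
        exact ⟨x, (Finset.mem_filter.1 (Finset.mem_coe.1 hx)).1, rfl⟩
    rw [e, Set.InjOn.ncard_image, Set.ncard_coe_finset]
    intro x hx y hy h
    have hx' := (Finset.mem_filter.1 (Finset.mem_coe.1 hx)).2
    have hy' := (Finset.mem_filter.1 (Finset.mem_coe.1 hy)).2
    rcases hsc x y ((class_eq_iff π x y).1 h) with h | h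
    · exact h
    · rw [← h, hinv] at hy'
      omega

/-- Let `n` be a positive even integer and `π` a pairing of `[n]` with no
crossing (no `1 ≤ u < u' < v < v' ≤ n` with `π(u) = v` and `π(u') = v'`). Then
`#(π⁻¹γ_n) = n/2 + 1`; equivalently, `#(π) + #(π⁻¹γ_n) + #(γ_n) = n + 2`. -/
theorem noncrossing_pairing_cycle_count (n : ℕ) (hn : 0 < n) (hne : Even n)
    (π : Equiv.Perm ℤ) (hπ : IsPairingOn π (posSet n))
    (hnc : ¬∃ u u' v v' : ℤ, 1 ≤ u ∧ u < u' ∧ u' < v ∧ v < v' ∧ v' ≤ (n : ℤ) ∧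
      π u = v ∧ π u' = v') :
    cyclesOn (π⁻¹ * gammaZ n) (posSet n) = n / 2 + 1 ∧
    cyclesOn π (posSet n) + cyclesOn (π⁻¹ * gammaZ n) (posSet n) +
      cyclesOn (gammaZ n) (posSet n) = n + 2 := by
  have hinv : ∀ x, π (π x) = x := fun x => by rw [← Equiv.Perm.mul_apply, hπ.1]; rfl
  have hπi : π⁻¹ = π := inv_eq_of_mul_eq_one_left hπ.1
  obtain ⟨hc, hcyc⟩ := pairing_count n π hπ
  have hsupp : ∀ x, ¬ (1 ≤ x ∧ x ≤ (n : ℤ)) → π x = x := fun x hx =>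
    hπ.2.2 x (fun h => hx (Finset.mem_Icc.1 h))
  have hm := main_induction n hn _ π hinv hsupp ?_ rfl
  · rw [hπi, hcyc, hm, gamma_one n hn]
    omega
  · intro u u' h1 h2 h3
    refine hnc ⟨u, u', π u, π u', ?_, h1, h2, h3, ?_, rfl, rfl⟩
    · by_contra h
      have := hsupp u (by omega)
      omega
    · by_contra h
      have := hsupp (π u') (by omega)
      rw [hinv] at this
      omega

end RibbonNC
end
end

section
/- Let A be a finite set, let π be a pairing of A, and let σ be any permutation of A. Then #(π) + #(π⁻¹σ) + #(σ) ≤ |A| + 2·c, where c is the number of orbits of the subgroup of S_A generated by π and σ. -/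
open Equiv MeasureTheory ProbabilityTheory

noncomputable section

namespace RibbonNC

/-- Counting classes of an equivalence relation as a dimension. -/
lemma ncard_eq_finrank {α : Type*} (A : Finset α) (r : Setoid α)
    (W : Submodule ℝ (A → ℝ))
    (h : ∀ f : A → ℝ, f ∈ W ↔ ∀ x y : A, r x y → f x = f y) :
    ((fun a => {b | r a b}) '' (A : Set α)).ncard = Module.finrank ℝ W := by
  classical
  let s : Setoid A := r.comap Subtype.val
  have hW : W = LinearMap.range (LinearMap.funLeft ℝ ℝ (Quotient.mk s)) := by
    ext f
    rw [h, LinearMap.mem_range]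
    constructor
    · intro hf
      exact ⟨fun q => Quotient.lift f hf q, rfl⟩
    · rintro ⟨g, rfl⟩ x y hxy
      simp only [LinearMap.funLeft_apply]
      exact congrArg g (Quotient.sound hxy)
  have hinj : Function.Injective (LinearMap.funLeft ℝ ℝ (Quotient.mk s)) :=
    LinearMap.funLeft_injective_of_surjective _ _ _ Quotient.mk_surjective
  rw [hW, LinearMap.finrank_range_of_inj hinj, Module.finrank_fintype_fun_eq_card,
    ← Nat.card_eq_fintype_card]
  have hwd : ∀ x y : A, s x y → {b | r x.1 b} = {b | r y.1 b} := by
    intro x y hxy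
    ext b
    exact ⟨fun hb => r.trans (r.symm hxy) hb, fun hb => r.trans hxy hb⟩
  let g : Quotient s → Set α := Quotient.lift (fun x : A => {b | r x.1 b}) hwd
  have hg : Function.Injective g := by
    intro p q
    refine Quotient.inductionOn₂ p q ?_
    intro x y hxy
    apply Quotient.sound
    have : (y : α) ∈ {b | r x.1 b} := by
      have e : {b | r x.1 b} = {b | r y.1 b} := hxy
      rw [e]
      exact r.refl _
    exact this
  rw [← Set.ncard_univ, ← Set.ncard_image_of_injective _ hg]
  congr 1
  ext t
  constructor
  · rintro ⟨a, ha, rfl⟩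
    exact ⟨Quotient.mk s ⟨a, ha⟩, trivial, rfl⟩
  · rintro ⟨q, -, rfl⟩
    obtain ⟨⟨x, hx⟩, rfl⟩ := Quotient.exists_rep q
    exact ⟨x, hx, rfl⟩

/-- The linear algebra (Scott's lemma) core of the inequality. -/
lemma finrank_core {B : Type*} [Fintype B] (p s : Equiv.Perm B) :
    Module.finrank ℝ (LinearMap.ker (LinearMap.funLeft ℝ ℝ p - 1)) +
      Module.finrank ℝ (LinearMap.ker (LinearMap.funLeft ℝ ℝ p - LinearMap.funLeft ℝ ℝ s)) +
      Module.finrank ℝ (LinearMap.ker (LinearMap.funLeft ℝ ℝ s - 1)) ≤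
    Fintype.card B + 2 * Module.finrank ℝ
      (LinearMap.ker (LinearMap.funLeft ℝ ℝ p - 1) ⊓
        LinearMap.ker (LinearMap.funLeft ℝ ℝ s - 1) : Submodule ℝ (B → ℝ)) := by
  set P := LinearMap.funLeft ℝ ℝ p with hP
  set S := LinearMap.funLeft ℝ ℝ s with hS
  set VP := LinearMap.ker (P - 1)
  set VS := LinearMap.ker (S - 1)
  set W := LinearMap.ker (P - S)
  have key : ∀ (q : Equiv.Perm B) (x y : B → ℝ), (∀ b, x (q b) = x b) →
      ∑ b, x b * (y (q b) - y b) = 0 := by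
    intro q x y hx
    simp only [mul_sub, Finset.sum_sub_distrib]
    rw [← Equiv.sum_comp q (fun b => x b * y b)]
    simp [hx]
  let φ : W →ₗ[ℝ] (B → ℝ) := (P - 1).domRestrict W
  have hker : Module.finrank ℝ (LinearMap.ker φ) ≤
      Module.finrank ℝ (VP ⊓ VS : Submodule ℝ (B → ℝ)) := by
    have : (LinearMap.ker φ).map W.subtype ≤ VP ⊓ VS := by
      rintro _ ⟨⟨x, hx⟩, hk, rfl⟩
      have h1 : (P - 1) x = 0 := hk
      have h2 : (P - S) x = 0 := hx
      refine ⟨h1, ?_⟩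
      change (S - 1) x = 0
      have : (S - 1) x = (P - 1) x - (P - S) x := by
        simp [LinearMap.sub_apply]
      rw [this, h1, h2, sub_zero]
    calc _ = Module.finrank ℝ ((LinearMap.ker φ).map W.subtype) :=
          (LinearEquiv.finrank_eq (Submodule.equivMapOfInjective _ W.injective_subtype _))
      _ ≤ _ := Submodule.finrank_mono this
  have hdisj : Disjoint (VP ⊔ VS) (LinearMap.range φ) := by
    rw [Submodule.disjoint_def]
    rintro z hz ⟨⟨w, hw⟩, rfl⟩
    obtain ⟨x, hx, y, hy, hxy⟩ := Submodule.mem_sup.1 hz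
    have hw' : ∀ b, w (p b) = w (s b) := by
      intro b
      have := congrFun (show (P - S) w = 0 from hw) b
      simpa [hP, hS, LinearMap.funLeft_apply, sub_eq_zero] using this
    have hx' : ∀ b, x (p b) = x b := by
      intro b
      have := congrFun (show (P - 1) x = 0 from hx) b
      simpa [hP, hS, LinearMap.funLeft_apply, sub_eq_zero] using this
    have hy' : ∀ b, y (s b) = y b := by
      intro b
      have := congrFun (show (S - 1) y = 0 from hy) b
      simpa [hP, hS, LinearMap.funLeft_apply, sub_eq_zero] using this
    have hφ : ∀ b, φ ⟨w, hw⟩ b = w (p b) - w b := by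
      intro b
      simp [φ, hP, LinearMap.funLeft_apply]
    have hsum : ∑ b, φ ⟨w, hw⟩ b * φ ⟨w, hw⟩ b = 0 := by
      have e1 := key p x w hx'
      have e2 := key s y w hy'
      calc _ = ∑ b, (x b * (w (p b) - w b) + y b * (w (s b) - w b)) := by
            apply Finset.sum_congr rfl
            intro b _
            have h3 : φ ⟨w, hw⟩ b = x b + y b := by rw [← hxy]; rfl
            nth_rewrite 1 [h3]
            rw [hφ, add_mul, hw']
        _ = 0 := by rw [Finset.sum_add_distrib, e1, e2, add_zero]
    funext b
    have := (Finset.sum_eq_zero_iff_of_nonneg (fun b _ => mul_self_nonneg _)).1 hsum b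
      (Finset.mem_univ b)
    simpa using this
  have h1 := Submodule.finrank_add_finrank_le_of_disjoint hdisj
  have h2 := Submodule.finrank_sup_add_finrank_inf_eq VP VS
  have h3 := φ.finrank_range_add_finrank_ker
  rw [Module.finrank_fintype_fun_eq_card] at h1
  omega

/-- Orbit relation of the group generated by a set of permutations. -/
def orbSetoid {α : Type*} (T : Set (Equiv.Perm α)) : Setoid α where
  r a b := ∃ w ∈ Subgroup.closure T, w a = b
  iseqv := by
    refine ⟨fun a => ⟨1, one_mem _, rfl⟩, ?_, ?_⟩
    · rintro a _ ⟨w, hw, rfl⟩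
      exact ⟨w⁻¹, inv_mem hw, by simp⟩
    · rintro a _ _ ⟨w, hw, rfl⟩ ⟨v, hv, rfl⟩
      exact ⟨v * w, mul_mem hv hw, rfl⟩

lemma orb_const_iff {α : Type*} (A : Finset α) (T : Set (Equiv.Perm α))
    (hT : ∀ t ∈ T, ∀ x, t x ∈ A ↔ x ∈ A) (f : A → ℝ) :
    (∀ x y : A, orbSetoid T x y → f x = f y) ↔
      ∀ t, ∀ ht : t ∈ T, ∀ x : A, f ⟨t x, (hT t ht x).2 x.2⟩ = f x := by
  classical
  constructor
  · intro h t ht x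
    exact (h x ⟨t x, (hT t ht x).2 x.2⟩ ⟨t, Subgroup.subset_closure ht, rfl⟩).symm
  · rintro h ⟨x, hx⟩ ⟨y, hy⟩ ⟨w, hw, hwx⟩
    let F : α → ℝ := fun x => if h : x ∈ A then f ⟨x, h⟩ else 0
    have hF : ∀ w ∈ Subgroup.closure T, ∀ x, F (w x) = F x := by
      intro w hw
      induction hw using Subgroup.closure_induction with
      | mem t ht =>
        intro x
        by_cases hx : x ∈ A
        · have := h t ht ⟨x, hx⟩
          simpa [F, hx, (hT t ht x).2 hx] using this
        · have h' : t x ∉ A := fun h => hx ((hT t ht x).1 h)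
          simp [F, hx, h']
      | one => intro x; rfl
      | mul v w _ _ hv hw => intro x; rw [Equiv.Perm.mul_apply, hv, hw]
      | inv v _ hv => intro x; rw [← hv (v⁻¹ x)]; simp
    have := hF w hw x
    simp only at hwx
    rw [hwx] at this
    simpa [F, hx, hy] using this.symm

lemma IsPermOn.mem_iff {α : Type*} {σ : Equiv.Perm α} {A : Finset α} (h : IsPermOn σ A)
    (x : α) : σ x ∈ A ↔ x ∈ A := by
  constructor
  · intro hx
    by_contra hn
    rw [h x hn] at hx
    exact hn hx
  · intro hx
    by_contra hn
    have := σ.injective (h _ hn)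
    rw [this] at hn
    exact hn hx

lemma cyclesOn_eq {α : Type*} (A : Finset α) (σ : Equiv.Perm α)
    (hσ : ∀ x, σ x ∈ A ↔ x ∈ A) (W : Submodule ℝ (A → ℝ))
    (h : ∀ f : A → ℝ, f ∈ W ↔ ∀ x : A, f ⟨σ x, (hσ x).2 x.2⟩ = f x) :
    cyclesOn σ A = Module.finrank ℝ W := by
  have hT : ∀ t ∈ ({σ} : Set (Equiv.Perm α)), ∀ x, t x ∈ A ↔ x ∈ A := by
    rintro t rfl
    exact hσ
  rw [← ncard_eq_finrank A (orbSetoid {σ}) W]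
  · unfold cyclesOn
    congr 2
    funext a
    ext b
    change σ.SameCycle a b ↔ ∃ w ∈ Subgroup.closure {σ}, w a = b
    rw [← Subgroup.zpowers_eq_closure]
    constructor
    · rintro ⟨i, hi⟩
      exact ⟨σ ^ i, ⟨i, rfl⟩, hi⟩
    · rintro ⟨_, ⟨i, rfl⟩, hi⟩
      exact ⟨i, hi⟩
  · intro f
    rw [orb_const_iff A _ hT, h]
    constructor
    · rintro h t rfl
      exact h
    · intro h
      exact h σ rfl

/-- For a finite set `A`, a pairing `π` of `A` and any permutation `σ` of
`A`, one has `#(π) + #(π⁻¹σ) + #(σ) ≤ |A| + 2c`, where `c` is the number of orbits of the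
subgroup generated by `π` and `σ`. -/
theorem cycle_count_genus_inequality {α : Type*} (A : Finset α) (π σ : Equiv.Perm α)
    (hπ : IsPairingOn π A) (hσ : IsPermOn σ A) (c : ℕ)
    (hc : c = ((fun a => {b | ∃ w ∈ Subgroup.closure ({π, σ} : Set (Equiv.Perm α)),
      w a = b}) '' (A : Set α)).ncard) :
    cyclesOn π A + cyclesOn (π⁻¹ * σ) A + cyclesOn σ A ≤ A.card + 2 * c := by
  have mπ := hπ.2.2.mem_iff
  have mσ := hσ.mem_iff
  have mπi : ∀ x, π⁻¹ x ∈ A ↔ x ∈ A := by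
    intro x
    rw [← mπ (π⁻¹ x)]
    simp
  have mσi : ∀ x, σ⁻¹ x ∈ A ↔ x ∈ A := by
    intro x
    rw [← mσ (σ⁻¹ x)]
    simp
  let p : Equiv.Perm A := π⁻¹.subtypePerm mπi
  let s : Equiv.Perm A := σ⁻¹.subtypePerm mσi
  have hp : ∀ f : A → ℝ, f ∈ LinearMap.ker (LinearMap.funLeft ℝ ℝ p - 1) ↔
      ∀ x : A, f ⟨π x, (mπ x).2 x.2⟩ = f x := by
    intro f
    rw [LinearMap.mem_ker, funext_iff]
    simp only [LinearMap.sub_apply, Pi.sub_apply, LinearMap.funLeft_apply, Module.End.one_apply,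
      Pi.zero_apply, sub_eq_zero]
    constructor
    · intro h x
      rw [← h ⟨π x, (mπ x).2 x.2⟩]
      congr 1
      simp [p]
    · intro h x
      rw [← h (p x)]
      congr 1
      simp [p]
  have hs : ∀ f : A → ℝ, f ∈ LinearMap.ker (LinearMap.funLeft ℝ ℝ s - 1) ↔
      ∀ x : A, f ⟨σ x, (mσ x).2 x.2⟩ = f x := by
    intro f
    rw [LinearMap.mem_ker, funext_iff]
    simp only [LinearMap.sub_apply, Pi.sub_apply, LinearMap.funLeft_apply, Module.End.one_apply,
      Pi.zero_apply, sub_eq_zero]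
    constructor
    · intro h x
      rw [← h ⟨σ x, (mσ x).2 x.2⟩]
      congr 1
      simp [s]
    · intro h x
      rw [← h (s x)]
      congr 1
      simp [s]
  have mps : ∀ x, (π⁻¹ * σ) x ∈ A ↔ x ∈ A := by
    intro x
    rw [Equiv.Perm.mul_apply, mπi, mσ]
  have hps : ∀ f : A → ℝ, f ∈ LinearMap.ker (LinearMap.funLeft ℝ ℝ p - LinearMap.funLeft ℝ ℝ s) ↔
      ∀ x : A, f ⟨(π⁻¹ * σ) x, (mps x).2 x.2⟩ = f x := by
    intro f
    rw [LinearMap.mem_ker, funext_iff]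
    simp only [LinearMap.sub_apply, Pi.sub_apply, LinearMap.funLeft_apply,
      Pi.zero_apply, sub_eq_zero]
    constructor
    · intro h x
      have := h ⟨σ x, (mσ x).2 x.2⟩
      convert this using 2
      · rfl
      · simp [s]
    · intro h x
      have := h (s x)
      rw [← this]
      congr 1
      simp [s, p]
  rw [cyclesOn_eq A π mπ _ hp, cyclesOn_eq A σ mσ _ hs, cyclesOn_eq A _ mps _ hps]
  have hT : ∀ t ∈ ({π, σ} : Set (Equiv.Perm α)), ∀ x, t x ∈ A ↔ x ∈ A := by
    rintro t (rfl | rfl)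
    · exact mπ
    · exact mσ
  have hcc := ncard_eq_finrank A (orbSetoid {π, σ})
    (LinearMap.ker (LinearMap.funLeft ℝ ℝ p - 1) ⊓ LinearMap.ker (LinearMap.funLeft ℝ ℝ s - 1))
    (by
      intro f
      rw [orb_const_iff A _ hT, Submodule.mem_inf, hp, hs]
      constructor
      · rintro ⟨h1, h2⟩ t (rfl | rfl)
        · exact h1
        · exact h2
      · intro h
        exact ⟨h π (Or.inl rfl), h σ (Or.inr rfl)⟩)
  have hc' : c = _ := hc.trans hcc
  rw [hc']
  have := finrank_core p s
  rwa [Fintype.card_coe] at this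

end RibbonNC
end
end

section
/- Let n ≥ 1, p ≥ 1, and let π ∈ ã_{1,p}(n). Then there exists an odd u ∈ [2n] such that the pair (u, π(u)) is crossing with π(u) > u; that is, there exist odd u ∈ [2n] and u' ∈ [2n] with u < u' < π(u) < π(u'). -/
open Equiv MeasureTheory ProbabilityTheory

noncomputable section

namespace RibbonNC

lemma gammaZ_eq (N : ℕ) :
    gammaZ N = ((List.range N).map fun i : ℕ => ((i : ℤ) + 1)).formPerm := by
  unfold gammaZ
  congr 1
  simp [List.map_eq_flatMap, List.flatMap_assoc]

lemma gammaZ_out (N : ℕ) (i : ℤ) (hi : i ∉ posSet N) : gammaZ N i = i := by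
  rw [gammaZ_eq]
  apply List.formPerm_apply_of_notMem
  intro h
  apply hi
  simp only [List.mem_map, List.mem_range] at h
  obtain ⟨k, hk, rfl⟩ := h
  simp only [posSet, Finset.mem_Icc]
  omega

lemma gammaZ_nodup (N : ℕ) : ((List.range N).map fun i : ℕ => ((i : ℤ) + 1)).Nodup := by
  apply List.Nodup.map _ List.nodup_range
  intro a b h
  simpa using h

lemma gammaZ_lt (N : ℕ) (i : ℤ) (h1 : 1 ≤ i) (h2 : i < N) : gammaZ N i = i + 1 := by
  have := List.formPerm_apply_lt_getElem _ (gammaZ_nodup N) (i - 1).toNat (by simp; omega)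
  simp only [List.getElem_map, List.getElem_range] at this
  rw [gammaZ_eq]
  have e : (((i - 1).toNat : ℤ) + 1) = i := by omega
  rw [e] at this
  rw [this]
  push_cast
  omega

lemma gammaZ_last (N : ℕ) (h : 1 ≤ N) : gammaZ N (N : ℤ) = 1 := by
  have := List.formPerm_apply_getElem _ (gammaZ_nodup N) (N - 1) (by simp; omega)
  simp only [List.getElem_map, List.getElem_range, List.length_map, List.length_range] at this
  rw [gammaZ_eq]
  have e : (((N - 1 : ℕ) : ℤ) + 1) = N := by omega
  have e2 : N - 1 + 1 = N := by omega
  rw [e, e2, Nat.mod_self] at this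
  simpa using this

/-- The arcs open at `i`. -/
def openAt (π : Equiv.Perm ℤ) (i : ℤ) : Set ℤ := {a | a ≤ i ∧ i < π a}

lemma openAt_step (N : ℕ) (hN : 1 ≤ N) (π : Equiv.Perm ℤ) (hπ : IsPairingOn π (posSet N))
    (hnc : ∀ u u' : ℤ, u < u' → u' < π u → π u < π u' → False) (i : ℤ) :
    openAt π (π (gammaZ N i)) = openAt π i := by
  obtain ⟨hinv, hfix, hout⟩ := hπ
  have inv : ∀ a, π (π a) = a := fun a => by
    have := congrArg (fun s : Equiv.Perm ℤ => s a) hinv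
    simpa using this
  have mem : ∀ a, a ∈ posSet N ↔ 1 ≤ a ∧ a ≤ N := fun a => by simp [posSet]
  have inS : ∀ a, a ∈ posSet N → π a ∈ posSet N := fun a ha => by
    by_contra h
    have := hout _ h
    rw [inv] at this
    exact h (this ▸ ha)
  have opS : ∀ a, a < π a → a ∈ posSet N := fun a ha => by
    by_contra h
    have := hout _ h
    omega
  by_cases hi : i ∈ posSet N
  swap
  · rw [gammaZ_out N i hi, hout i hi]
  have hi' := (mem i).1 hi
  rcases lt_or_eq_of_le hi'.2 with hlt | heq
  · rw [gammaZ_lt N i hi'.1 hlt]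
    have hm : i + 1 ∈ posSet N := (mem _).2 (by omega)
    have hd := inv (i + 1)
    have hne := hfix _ hm
    ext a
    simp only [openAt, Set.mem_ofPred_eq]
    have ha := inv a
    have k1 : π a = i + 1 → a = π (i + 1) := fun h => by rw [← h, ha]
    have k2 : a = i + 1 → π a = π (i + 1) := fun h => by rw [h]
    have k3 : π a = π (i + 1) → a = i + 1 := fun h => π.injective h
    have k4 : a = π (i + 1) → π a = i + 1 := fun h => by rw [h, hd]
    have c1 := hnc a (i + 1)
    have c2 := hnc (i + 1) a
    have c3 := hnc a (π (i + 1))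
    have c4 := hnc (π (i + 1)) a
    rw [hd] at c3 c4
    generalize π (i + 1) = d at *
    generalize π a = b at *
    grind
  · subst heq
    rw [gammaZ_last N hN]
    have hm : (1 : ℤ) ∈ posSet N := (mem _).2 (by omega)
    have hd := inv 1
    have hne := hfix _ hm
    have h1 := (mem _).1 (inS _ hm)
    ext a
    simp only [openAt, Set.mem_ofPred_eq]
    have ha := inv a
    have k2 : a = 1 → π a = π 1 := fun h => by rw [h]
    have k4 : a = π 1 → π a = 1 := fun h => by rw [h, hd]
    have c2 := hnc 1 a
    have o := opS a
    have o2 := inS a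
    rw [mem] at o o2
    rw [mem] at o2
    generalize π 1 = d at *
    generalize π a = b at *
    constructor <;> intro h <;> exfalso <;> grind

lemma openAt_sameCycle {π σ : Equiv.Perm ℤ} (h : ∀ i, openAt π (σ i) = openAt π i)
    {a b : ℤ} (hab : σ.SameCycle a b) : openAt π a = openAt π b := by
  have hp : ∀ (k : ℕ) (i : ℤ), openAt π ((σ ^ k) i) = openAt π i := by
    intro k
    induction k with
    | zero => intro i; simp
    | succ k ih => intro i; rw [pow_succ, Equiv.Perm.mul_apply, ih, h]
  obtain ⟨k, hk⟩ := hab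
  obtain ⟨m, rfl | rfl⟩ := k.eq_nat_or_neg
  · rw [← hk, zpow_natCast, hp]
  · rw [zpow_neg, zpow_natCast, Equiv.Perm.inv_eq_iff_eq] at hk
    rw [hk, hp]

lemma le_cycles_of_noncrossing (n : ℕ) (hn : 1 ≤ n) (π : Equiv.Perm ℤ)
    (hπ : IsPairingOn π (posSet (2 * n)))
    (hnc : ∀ u u' : ℤ, u < u' → u' < π u → π u < π u' → False) :
    n ≤ cyclesOn (π⁻¹ * gammaZ (2 * n)) (posSet (2 * n)) := by
  have hstep := openAt_step (2 * n) (by omega) π hπ hnc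
  obtain ⟨hinv, hfix, hout⟩ := hπ
  have inv : ∀ a, π (π a) = a := fun a => by
    have := congrArg (fun s : Equiv.Perm ℤ => s a) hinv
    simpa using this
  have hpi : π⁻¹ = π := inv_eq_of_mul_eq_one_left hinv
  rw [hpi]
  have inS : ∀ a, a ∈ posSet (2 * n) → π a ∈ posSet (2 * n) := fun a ha => by
    by_contra h
    have := hout _ h
    rw [inv] at this
    exact h (this ▸ ha)
  set S := posSet (2 * n) with hS
  set O := S.filter (fun a => a < π a) with hO
  have hcard : n ≤ O.card := by
    have hsub : S ⊆ O ∪ O.image π := by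
      intro a ha
      have := hfix a ha
      rcases lt_or_gt_of_ne this with h | h
      · apply Finset.mem_union_right
        rw [Finset.mem_image]
        exact ⟨π a, by rw [hO, Finset.mem_filter, inv]; exact ⟨inS a ha, h⟩, inv a⟩
      · apply Finset.mem_union_left
        rw [hO, Finset.mem_filter]
        exact ⟨ha, h⟩
    have h1 := Finset.card_le_card hsub
    have h2 := Finset.card_union_le O (O.image π)
    have h3 := Finset.card_image_le (s := O) (f := π)
    have h4 : S.card = 2 * n := by rw [hS, posSet, Int.card_Icc]; omega
    omega
  refine hcard.trans ?_
  unfold cyclesOn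
  rw [← Set.ncard_coe_finset O]
  refine Set.ncard_le_ncard_of_injOn (fun a => {b | (π * gammaZ (2 * n)).SameCycle a b})
    ?_ ?_ (S.finite_toSet.image _)
  · intro a ha
    exact ⟨a, (Finset.mem_filter.1 (Finset.mem_coe.1 ha)).1, rfl⟩
  · intro a ha b hb hab
    have ha' := (Finset.mem_filter.1 (Finset.mem_coe.1 ha)).2
    have hb' := (Finset.mem_filter.1 (Finset.mem_coe.1 hb)).2
    have hsc : (π * gammaZ (2 * n)).SameCycle a b := by
      have : b ∈ {c | (π * gammaZ (2 * n)).SameCycle b c} := Equiv.Perm.SameCycle.refl _ _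
      simp only at hab
      rw [← hab] at this
      exact this
    have heq : openAt π a = openAt π b := openAt_sameCycle (fun i => hstep i) hsc
    have m1 : a ∈ openAt π b := heq ▸ (⟨le_refl a, ha'⟩ : a ∈ openAt π a)
    have m2 : b ∈ openAt π a := heq ▸ (⟨le_refl b, hb'⟩ : b ∈ openAt π b)
    exact le_antisymm m1.1 m2.1

lemma no_crossing (n : ℕ) (π : Equiv.Perm ℤ)
    (hπ : IsPairingOn π (posSet (2 * n)))
    (hpar : ∀ a ∈ posSet (2 * n), Even a → Odd (π a))
    (hno : ∀ u u' : ℤ, Odd u → u < u' → u' < π u → π u < π u' → False) :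
    ∀ u u' : ℤ, u < u' → u' < π u → π u < π u' → False := by
  obtain ⟨hinv, hfix, hout⟩ := hπ
  have inv : ∀ a, π (π a) = a := fun a => by
    have := congrArg (fun s : Equiv.Perm ℤ => s a) hinv
    simpa using this
  have mem : ∀ a, a ∈ posSet (2 * n) ↔ 1 ≤ a ∧ a ≤ 2 * n := fun a => by simp [posSet]
  have opS : ∀ a, a < π a → a ∈ posSet (2 * n) := fun a ha => by
    by_contra h
    have := hout _ h
    omega
  have inS : ∀ a, a ∈ posSet (2 * n) → π a ∈ posSet (2 * n) := fun a ha => by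
    by_contra h
    have := hout _ h
    rw [inv] at this
    exact h (this ▸ ha)
  classical
  by_contra hcon
  push Not at hcon
  obtain ⟨u0, x0, h1, h2, h3, -⟩ := hcon
  set T := (posSet (2 * n)).filter (fun x => ∃ u, u < x ∧ x < π u ∧ π u < π x) with hT
  have hne : T.Nonempty := ⟨x0, Finset.mem_filter.2 ⟨opS _ (by omega), u0, h1, h2, h3⟩⟩
  obtain ⟨x, hxT, hmax⟩ := T.exists_max_image π hne
  obtain ⟨hxS, u, hu1, hu2, hu3⟩ := Finset.mem_filter.1 hxT
  have hcS := inS x hxS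
  have hxb := (mem _).1 hxS
  have hcb := (mem _).1 hcS
  have huS := opS u (by omega)
  have hue : Even u := by
    by_contra h
    exact hno u x (Int.not_even_iff_odd.1 h) hu1 hu2 hu3
  have huo := hpar u huS hue
  set D := Finset.Ioo x (π x) with hD
  have hlt : (D.filter Even).card < (D.filter Odd).card := by
    have himg : (D.filter Even).image π ⊂ D.filter Odd := by
      rw [Finset.ssubset_iff_of_subset]
      · refine ⟨π u, ?_, ?_⟩
        · rw [Finset.mem_filter, hD, Finset.mem_Ioo]
          exact ⟨⟨hu2, hu3⟩, huo⟩
        · intro h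
          obtain ⟨y, hy, hyu⟩ := Finset.mem_image.1 h
          have := π.injective hyu
          subst this
          have := (Finset.mem_Ioo.1 (Finset.mem_filter.1 hy).1).1
          omega
      · intro z hz
        obtain ⟨y, hy, rfl⟩ := Finset.mem_image.1 hz
        obtain ⟨hyD, hye⟩ := Finset.mem_filter.1 hy
        obtain ⟨hy1, hy2⟩ := Finset.mem_Ioo.1 hyD
        have hyS : y ∈ posSet (2 * n) := (mem y).2 (by omega)
        have hyo := hpar y hyS hye
        rw [Finset.mem_filter, hD, Finset.mem_Ioo]
        refine ⟨⟨?_, ?_⟩, hyo⟩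
        · by_contra h
          rcases lt_or_eq_of_le (not_lt.1 h) with h | h
          · exact hno (π y) x hyo h (by rw [inv]; exact hy1) (by rw [inv]; exact hy2)
          · rw [← h, inv] at hy2
            omega
        · by_contra h
          rcases lt_or_eq_of_le (not_lt.1 h) with h | h
          · have := hmax y (Finset.mem_filter.2 ⟨hyS, x, hy1, hy2, h⟩)
            omega
          · have := π.injective h
            omega
    have := Finset.card_lt_card himg
    rwa [Finset.card_image_of_injective _ π.injective] at this
  have hle : (D.filter Odd).card ≤ (D.filter Even).card := by
    rcases Int.even_or_odd x with hx | hx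
    · have hc := hpar x hxS hx
      refine Finset.card_le_card_of_injOn (fun j => j + 1) ?_ ?_
      · intro j hj
        simp only [hD, Finset.coe_filter, Finset.mem_Ioo, Set.mem_ofPred_eq] at hj ⊢
        refine ⟨⟨by omega, ?_⟩, hj.2.add_one⟩
        have := hj.2
        grind
      · intro a _ b _ h
        simpa using h
    · refine Finset.card_le_card_of_injOn (fun j => j - 1) ?_ ?_
      · intro j hj
        simp only [hD, Finset.coe_filter, Finset.mem_Ioo, Set.mem_ofPred_eq] at hj ⊢
        refine ⟨⟨?_, by omega⟩, hj.2.sub_odd odd_one⟩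
        have := hj.2
        grind
      · intro a _ b _ h
        simpa using h
  omega

/-- For `n ≥ 1`, `p ≥ 1` and `π ∈ ã_{1,p}(n)`, there exists an odd
`u ∈ [2n]` such that `(u, π(u))` is crossing with `π(u) > u`; that is, there are odd
`u ∈ [2n]` and `u' ∈ [2n]` with `u < u' < π(u) < π(u')`. -/
theorem exists_odd_crossing (n p : ℕ) (hn : 1 ≤ n) (hp : 1 ≤ p)
    (π : Equiv.Perm ℤ) (hπ : π ∈ aTildeSet 1 p n) :
    ∃ u u' : ℤ, u ∈ posSet (2 * n) ∧ Odd u ∧ u' ∈ posSet (2 * n) ∧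
      u < u' ∧ u' < π u ∧ π u < π u' := by
  obtain ⟨⟨hpair, hcyc⟩, hpar, -⟩ := hπ
  by_contra hcon
  have opS : ∀ a, a < π a → a ∈ posSet (2 * n) := fun a ha => by
    by_contra h
    have := hpair.2.2 _ h
    omega
  have hnc := no_crossing n π hpair hpar (fun u u' ho h1 h2 h3 =>
    hcon ⟨u, u', opS u (by omega), ho, opS u' (by omega), h1, h2, h3⟩)
  have := le_cycles_of_noncrossing n hn π hpair hnc
  omega

end RibbonNC
end
end
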